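/- Let n ∈ ℕ, q a primitive n-th root of unity, and T_q the Taft Hopf algebra. Let d be a divisor of n, n = dm, and for ξ ∈ k let 𝒜(d,ξ) be the algebra generated by h, w with relations h^d = 1, hw = q^m wh, w^n = ξ1, made a left T_q-comodule algebra by λ(h) = g^m⊗h, λ(w) = x⊗1 + g⊗w. Let K(d) be the left coideal subalgebra of T_q generated by g^m and x. Then for every ξ ∈ k there is a cocentral Hopf 2-cocycle σ_ξ on T_q with 𝒜(d,ξ) ≅ K(d)_{σ_ξ} as T_q-comodule algebras; in particular 𝒜(d,ξ) is a right T_q-simple left T_q-comodule algebra with 𝒜(d,ξ)^{co T_q} = k. -/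

import Mathlib

open TensorProduct

noncomputable section

namespace HopfPaper

variable (k : Type) [CommRing k]

/-- The image submodule `p ⊗ q ⊆ M ⊗ N` of a pair of submodules. -/
def tsub {M N : Type} [AddCommGroup M] [Module k M] [AddCommGroup N] [Module k N]
    (p : Submodule k M) (q : Submodule k N) : Submodule k (M ⊗[k] N) :=
  LinearMap.range (TensorProduct.mapIncl p q)

/-- A left `H`-comodule algebra structure on the `k`-algebra `A`:
an algebra map `λ : A → H ⊗ A` which is coassociative and counital. -/
structure ComodAlg (H A : Type) [Ring H] [HopfAlgebra k H] [Ring A] [Algebra k A] where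
  lam : A →ₐ[k] H ⊗[k] A
  coassoc : (Coalgebra.comul (R := k) (A := H)).rTensor A ∘ₗ lam.toLinearMap
      = (TensorProduct.assoc k H H A).symm.toLinearMap ∘ₗ
          lam.toLinearMap.lTensor H ∘ₗ lam.toLinearMap
  counital : (Coalgebra.counit (R := k) (A := H)).rTensor A ∘ₗ lam.toLinearMap
      = TensorProduct.mk k k A 1

variable {k}

/-- A right ideal of `A` which is costable under the coaction, i.e. `λ(J) ⊆ H ⊗ J`. -/
def ComodAlg.IsCostableRightIdeal {H A : Type} [Ring H] [HopfAlgebra k H] [Ring A] [Algebra k A]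
    (c : ComodAlg k H A) (J : Submodule k A) : Prop :=
  (∀ j ∈ J, ∀ a : A, j * a ∈ J) ∧
    Submodule.map c.lam.toLinearMap J ≤ tsub k (⊤ : Submodule k H) J

/-- `A` is right `H`-simple: it has no nontrivial `H`-costable right ideal. -/
def ComodAlg.RightSimple {H A : Type} [Ring H] [HopfAlgebra k H] [Ring A] [Algebra k A]
    (c : ComodAlg k H A) : Prop :=
  ∀ J : Submodule k A, c.IsCostableRightIdeal J → J = ⊥ ∨ J = ⊤

/-- The coinvariants of `A` are trivial: `A^{co H} = k`. -/
def ComodAlg.TrivialCoinv {H A : Type} [Ring H] [HopfAlgebra k H] [Ring A] [Algebra k A]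
    (c : ComodAlg k H A) : Prop :=
  ∀ a : A, c.lam a = 1 ⊗ₜ[k] a ↔ ∃ t : k, a = t • (1 : A)

end HopfPaper

namespace HopfPaper

section Cocycle

variable (k : Type) [CommRing k] (H : Type) [Ring H] [HopfAlgebra k H]

/-- Convolution product of two functionals on a coalgebra. -/
def conv {C : Type} [AddCommGroup C] [Module k C] [Coalgebra k C]
    (f g : C →ₗ[k] k) : C →ₗ[k] k :=
  LinearMap.mul' k k ∘ₗ TensorProduct.map f g ∘ₗ Coalgebra.comul

/-- The map `(x⊗y)⊗z ↦ σ(x₁,y₁)σ(x₂y₂,z)` (left-hand side of the 2-cocycle condition). -/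
def cocycleLHS (σ : H ⊗[k] H →ₗ[k] k) : (H ⊗[k] H) ⊗[k] H →ₗ[k] k :=
  LinearMap.mul' k k ∘ₗ
    TensorProduct.map σ (σ ∘ₗ TensorProduct.map (LinearMap.mul' k H) LinearMap.id) ∘ₗ
    (TensorProduct.assoc k (H ⊗[k] H) (H ⊗[k] H) H).toLinearMap ∘ₗ
    (Coalgebra.comul (R := k) (A := H ⊗[k] H)).rTensor H

/-- The map `(x⊗y)⊗z ↦ σ(y₁,z₁)σ(x,y₂z₂)` (right-hand side of the 2-cocycle condition). -/
def cocycleRHS (σ : H ⊗[k] H →ₗ[k] k) : (H ⊗[k] H) ⊗[k] H →ₗ[k] k :=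
  LinearMap.mul' k k ∘ₗ TensorProduct.map σ σ ∘ₗ
    (TensorProduct.leftComm k H (H ⊗[k] H) H).toLinearMap ∘ₗ
    (((LinearMap.mul' k H).lTensor (H ⊗[k] H)).lTensor H) ∘ₗ
    ((Coalgebra.comul (R := k) (A := H ⊗[k] H)).lTensor H) ∘ₗ
    (TensorProduct.assoc k H H H).toLinearMap

/-- A Hopf 2-cocycle `σ : H ⊗ H → k`: convolution invertible, satisfying
`σ(x₁,y₁)σ(x₂y₂,z) = σ(y₁,z₁)σ(x,y₂z₂)` and `σ(x,1) = ε(x) = σ(1,x)`. -/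
structure HopfTwoCocycle where
  σ : H ⊗[k] H →ₗ[k] k
  σinv : H ⊗[k] H →ₗ[k] k
  conv_inv_left : conv k σinv σ = Coalgebra.counit
  conv_inv_right : conv k σ σinv = Coalgebra.counit
  cocycle : cocycleLHS k H σ = cocycleRHS k H σ
  unital_left : ∀ x : H, σ ((1 : H) ⊗ₜ[k] x) = Coalgebra.counit (R := k) x
  unital_right : ∀ x : H, σ (x ⊗ₜ[k] (1 : H)) = Coalgebra.counit (R := k) x

/-- The map `x ⊗ y ↦ σ(x₁,y₁) x₂y₂`. -/
def mulTwistL (σ : H ⊗[k] H →ₗ[k] k) : H ⊗[k] H →ₗ[k] H :=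
  (TensorProduct.lid k H).toLinearMap ∘ₗ
    TensorProduct.map σ (LinearMap.mul' k H) ∘ₗ Coalgebra.comul (R := k) (A := H ⊗[k] H)

/-- The map `x ⊗ y ↦ σ(x₂,y₂) x₁y₁` (the multiplication of `σH`). -/
def mulTwistR (σ : H ⊗[k] H →ₗ[k] k) : H ⊗[k] H →ₗ[k] H :=
  (TensorProduct.rid k H).toLinearMap ∘ₗ
    TensorProduct.map (LinearMap.mul' k H) σ ∘ₗ Coalgebra.comul (R := k) (A := H ⊗[k] H)

/-- `σ` is cocentral: `σ(x₁,y₁) x₂y₂ = σ(x₂,y₂) x₁y₁`. -/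
def IsCocentral (σ : H ⊗[k] H →ₗ[k] k) : Prop :=
  mulTwistL k H σ = mulTwistR k H σ

/-- The multiplication `x·y = σ(x₁,y₁) σ⁻¹(x₃,y₃) x₂y₂` of the twisted Hopf algebra `H^σ`. -/
def mulHsigma (c : HopfTwoCocycle k H) : H ⊗[k] H →ₗ[k] H :=
  (TensorProduct.rid k H).toLinearMap ∘ₗ
    (TensorProduct.lid k (H ⊗[k] k)).toLinearMap ∘ₗ
    TensorProduct.map c.σ (TensorProduct.map (LinearMap.mul' k H) c.σinv) ∘ₗ
    ((Coalgebra.comul (R := k) (A := H ⊗[k] H)).lTensor (H ⊗[k] H)) ∘ₗ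
    Coalgebra.comul (R := k) (A := H ⊗[k] H)

variable {K : Type} [Ring K] [Algebra k K]

/-- The twisted multiplication `a ·σ b = σ(a₍₋₁₎,b₍₋₁₎) a₀b₀` on a left `H`-comodule
algebra `K`; this is the multiplication of `K_σ`. -/
def mulKsigma (cK : ComodAlg k H K) (σ : H ⊗[k] H →ₗ[k] k) : K ⊗[k] K →ₗ[k] K :=
  (TensorProduct.lid k K).toLinearMap ∘ₗ
    TensorProduct.map σ (LinearMap.mul' k K) ∘ₗ
    (TensorProduct.tensorTensorTensorComm k H K H K).toLinearMap ∘ₗ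
    TensorProduct.map cK.lam.toLinearMap cK.lam.toLinearMap

end Cocycle

end HopfPaper

namespace HopfPaper

/-- The Gaussian binomial coefficient at `q`, defined by its Pascal recursion. -/
def gaussBinom {k : Type} [Field k] (q : k) : ℕ → ℕ → k
  | _, 0 => 1
  | 0, _ + 1 => 0
  | j + 1, s + 1 => gaussBinom q j s + q ^ (s + 1) * gaussBinom q j (s + 1)

section QBinomial

variable {k : Type} [Field k] (q : k)

lemma gaussBinom_zero_right (j : ℕ) : gaussBinom q j 0 = 1 := by
  cases j <;> simp [gaussBinom]

lemma gaussBinom_succ_succ (j s : ℕ) : gaussBinom q (j + 1) (s + 1) =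
    gaussBinom q j s + q ^ (s + 1) * gaussBinom q j (s + 1) := by
  simp [gaussBinom]

lemma gaussBinom_eq_zero_of_lt (j : ℕ) : ∀ s, j < s → gaussBinom q j s = 0 := by
  induction j with
  | zero =>
    intro s hs
    obtain ⟨s, rfl⟩ := Nat.exists_eq_succ_of_ne_zero hs.ne'
    simp [gaussBinom]
  | succ j ih =>
    intro s hs
    obtain ⟨s, rfl⟩ := Nat.exists_eq_succ_of_ne_zero (Nat.ne_zero_of_lt hs)
    rw [Nat.succ_eq_add_one, gaussBinom_succ_succ, ih s (by omega), ih (s + 1) (by omega)]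
    simp

lemma gaussBinom_self (j : ℕ) : gaussBinom q j j = 1 := by
  induction j with
  | zero => simp [gaussBinom]
  | succ j ih =>
    rw [gaussBinom_succ_succ, ih, gaussBinom_eq_zero_of_lt q j (j + 1) (by omega)]
    simp

/-- Absorption identity `[s+1] (j+1 choose s+1) = [j+1] (j choose s)`. -/
lemma gaussBinom_absorption (j : ℕ) : ∀ s,
    (1 - q ^ (s + 1)) * gaussBinom q (j + 1) (s + 1) = (1 - q ^ (j + 1)) * gaussBinom q j s := by
  induction j with
  | zero =>
    intro s
    cases s with
    | zero => simp [gaussBinom]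
    | succ s => simp [gaussBinom]
  | succ j ih =>
    intro s
    rw [gaussBinom_succ_succ]
    have h1 := ih s
    cases s with
    | zero =>
      simp only [gaussBinom_zero_right] at h1 ⊢
      linear_combination q ^ (0 + 1) * h1
    | succ s =>
      have h2 := ih s
      have h3 := gaussBinom_succ_succ q j s
      linear_combination q ^ (s + 1 + 1) * h1 + q * h2 - q * (1 - q ^ (j + 1)) * h3

lemma gaussBinom_eq_zero_of_isPrimitiveRoot {n s : ℕ} (hq : IsPrimitiveRoot q n) (h0 : 0 < s)
    (hs : s < n) : gaussBinom q n s = 0 := by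
  obtain ⟨s, rfl⟩ := Nat.exists_eq_succ_of_ne_zero h0.ne'
  obtain ⟨n, rfl⟩ := Nat.exists_eq_succ_of_ne_zero (Nat.ne_zero_of_lt hs)
  have h := gaussBinom_absorption q n s
  rw [hq.pow_eq_one, sub_self, zero_mul] at h
  refine (mul_eq_zero.mp h).resolve_left (sub_ne_zero.mpr fun e => ?_)
  exact hq.pow_ne_one_of_pos_of_lt h0.ne' hs e.symm

variable {q} {R : Type} [Ring R] [Algebra k R]

/-- If `a * b = c • (b * a)` then `a ^ i * b ^ j = c ^ (i * j) • (b ^ j * a ^ i)`. -/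
lemma pow_mul_pow_of_mul_eq_smul {a b : R} {c : k} (hab : a * b = c • (b * a)) (i j : ℕ) :
    a ^ i * b ^ j = c ^ (i * j) • (b ^ j * a ^ i) := by
  have h1 : ∀ j, a * b ^ j = c ^ j • (b ^ j * a) := by
    intro j
    induction j with
    | zero => simp
    | succ j ih =>
      rw [pow_succ, ← mul_assoc, ih, smul_mul_assoc, mul_assoc, hab, mul_smul_comm, smul_smul,
        ← pow_succ, ← mul_assoc]
  induction i with
  | zero => simp
  | succ i ih =>
    rw [pow_succ', mul_assoc, ih, mul_smul_comm, ← mul_assoc, h1, smul_mul_assoc, smul_smul,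
      mul_assoc, ← pow_add]
    congr 2
    ring

/-- The `q`-binomial theorem. -/
lemma add_pow_of_mul_eq_smul {X Y : R} (h : Y * X = q • (X * Y)) (j : ℕ) :
    (X + Y) ^ j = ∑ s ∈ Finset.range (j + 1), gaussBinom q j s • (X ^ s * Y ^ (j - s)) := by
  induction j with
  | zero => simp [gaussBinom]
  | succ j ih =>
    have hX : X * (X + Y) ^ j =
        ∑ s ∈ Finset.range (j + 1), gaussBinom q j s • (X ^ (s + 1) * Y ^ (j - s)) := by
      rw [ih, Finset.mul_sum]
      refine Finset.sum_congr rfl fun s _ => ?_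
      rw [mul_smul_comm, ← mul_assoc, ← pow_succ']
    have hY : Y * (X + Y) ^ j = ∑ s ∈ Finset.range (j + 1),
        (q ^ s * gaussBinom q j s) • (X ^ s * Y ^ (j + 1 - s)) := by
      rw [ih, Finset.mul_sum]
      refine Finset.sum_congr rfl fun s hs => ?_
      have hs' : j + 1 - s = (j - s) + 1 := by
        have := Finset.mem_range.mp hs
        omega
      have h1 := pow_mul_pow_of_mul_eq_smul h 1 s
      rw [pow_one, one_mul] at h1
      rw [mul_smul_comm, ← mul_assoc, h1, smul_mul_assoc, smul_smul, hs', mul_assoc, ← pow_succ',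
        mul_comm]
    have hY' : Y * (X + Y) ^ j = Y ^ (j + 1) + ∑ s ∈ Finset.range (j + 1),
        (q ^ (s + 1) * gaussBinom q j (s + 1)) • (X ^ (s + 1) * Y ^ (j - s)) := by
      rw [hY, Finset.sum_range_succ', Finset.sum_range_succ _ j,
        gaussBinom_eq_zero_of_lt q j (j + 1) (by omega)]
      simp [gaussBinom_zero_right, add_comm]
    rw [pow_succ', add_mul, hX, hY', Finset.sum_range_succ' _ (j + 1)]
    simp only [gaussBinom_succ_succ, add_smul, Finset.sum_add_distrib, gaussBinom_zero_right,
      Nat.add_sub_add_right, pow_zero, one_mul, one_smul, Nat.sub_zero]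
    abel

lemma add_pow_of_isPrimitiveRoot {n : ℕ} (hn : 0 < n) (hq : IsPrimitiveRoot q n) {X Y : R}
    (h : Y * X = q • (X * Y)) : (X + Y) ^ n = X ^ n + Y ^ n := by
  obtain ⟨n, rfl⟩ := Nat.exists_eq_succ_of_ne_zero hn.ne'
  rw [add_pow_of_mul_eq_smul h, Finset.sum_range_succ, Finset.sum_range_succ',
    Finset.sum_eq_zero]
  · simp [gaussBinom_zero_right, gaussBinom_self, add_comm]
  · intro s hs
    rw [gaussBinom_eq_zero_of_isPrimitiveRoot q hq (by omega)
      (by have := Finset.mem_range.mp hs; omega), zero_smul]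

end QBinomial

/-- `T` is the Taft Hopf algebra on the generators `g` and `x`, with basis `g ^ i * x ^ j`. -/
structure IsTaft {k : Type} [Field k] (n : ℕ) (q : k) {T : Type} [Ring T] [HopfAlgebra k T]
    (g x : T) : Prop where
  pos : 0 < n
  primitive : IsPrimitiveRoot q n
  comm : g * x = q • (x * g)
  g_pow : g ^ n = 1
  x_pow : x ^ n = 0
  comul_g : Coalgebra.comul (R := k) g = g ⊗ₜ[k] g
  comul_x : Coalgebra.comul (R := k) x = x ⊗ₜ[k] 1 + g ⊗ₜ[k] x
  linInd : LinearIndependent k (fun t : Fin n × Fin n => g ^ (t.1 : ℕ) * x ^ (t.2 : ℕ))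
  span : Submodule.span k
    (Set.range (fun t : Fin n × Fin n => g ^ (t.1 : ℕ) * x ^ (t.2 : ℕ))) = ⊤

namespace IsTaft

variable {k : Type} [Field k] {n : ℕ} {q : k} {T : Type} [Ring T] [HopfAlgebra k T] {g x : T}
  (hT : IsTaft n q g x)

/-- The basis `g ^ i * x ^ j` of the Taft algebra. -/
def basis : Module.Basis (Fin n × Fin n) k T := Module.Basis.mk hT.linInd hT.span.ge

lemma basis_apply (t : Fin n × Fin n) : hT.basis t = g ^ (t.1 : ℕ) * x ^ (t.2 : ℕ) := by
  simp [basis]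

lemma q_ne_zero (hT : IsTaft n q g x) : q ≠ 0 := hT.primitive.ne_zero hT.pos.ne'

lemma g_pow_mod (hT : IsTaft n q g x) (i : ℕ) : g ^ (i % n) = g ^ i := by
  conv_rhs => rw [← Nat.mod_add_div i n, pow_add, pow_mul, hT.g_pow, one_pow, mul_one]

lemma q_inv_pow_mod (hT : IsTaft n q g x) (i : ℕ) : q⁻¹ ^ (i % n) = q⁻¹ ^ i := by
  conv_rhs => rw [← Nat.mod_add_div i n, pow_add, pow_mul, inv_pow q n, hT.primitive.pow_eq_one,
    inv_one, one_pow, mul_one]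

lemma g_pow_mul_x_pow_eq_basis (i j : ℕ) (hj : j < n) :
    g ^ i * x ^ j = hT.basis (⟨i % n, Nat.mod_lt i hT.pos⟩, ⟨j, hj⟩) := by
  rw [basis_apply, hT.g_pow_mod]

lemma x_pow_mul_g_pow (hT : IsTaft n q g x) (i j : ℕ) :
    x ^ j * g ^ i = q⁻¹ ^ (i * j) • (g ^ i * x ^ j) := by
  rw [pow_mul_pow_of_mul_eq_smul hT.comm, smul_smul, ← mul_pow, inv_mul_cancel₀ hT.q_ne_zero,
    one_pow, one_smul]

/-- Left multiplication by `w` on `T`, where `T` is identified, through its basis, with the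
algebra generated by `h` and `w` subject to `h ^ n = 1`, `h * w = q • (w * h)`, `w ^ n = ξ`. -/
def opX (ξ : k) : T →ₗ[k] T :=
  hT.basis.constr k fun t => q⁻¹ ^ (t.1 : ℕ) •
    if (t.2 : ℕ) + 1 < n then g ^ (t.1 : ℕ) * x ^ ((t.2 : ℕ) + 1) else ξ • g ^ (t.1 : ℕ)

lemma opX_apply (ξ : k) (i j : ℕ) (hj : j < n) : hT.opX ξ (g ^ i * x ^ j) =
    q⁻¹ ^ i • if j + 1 < n then g ^ i * x ^ (j + 1) else ξ • g ^ i := by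
  rw [hT.g_pow_mul_x_pow_eq_basis i j hj, opX, Module.Basis.constr_basis]
  simp only [hT.g_pow_mod, hT.q_inv_pow_mod]

lemma opX_zero (t : T) : hT.opX 0 t = x * t := by
  suffices h : hT.opX 0 = LinearMap.mulLeft k x from LinearMap.congr_fun h t
  refine hT.basis.ext fun t => ?_
  have h1 := hT.x_pow_mul_g_pow t.1 1
  rw [pow_one, mul_one] at h1
  rw [basis_apply, opX_apply _ _ _ _ t.2.2, LinearMap.mulLeft_apply, ← mul_assoc, h1,
    smul_mul_assoc, mul_assoc, ← pow_succ', zero_smul]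
  split_ifs with h
  · rfl
  · have h2 : (t.2 : ℕ) + 1 = n := by have := t.2.2; omega
    rw [h2, hT.x_pow, mul_zero]

lemma opX_g_mul (ξ : k) (t : T) : hT.opX ξ (g * t) = q⁻¹ • (g * hT.opX ξ t) := by
  suffices h : hT.opX ξ ∘ₗ LinearMap.mulLeft k g = q⁻¹ • (LinearMap.mulLeft k g ∘ₗ hT.opX ξ) from
    LinearMap.congr_fun h t
  refine hT.basis.ext fun t => ?_
  simp only [basis_apply, LinearMap.comp_apply, LinearMap.smul_apply, LinearMap.mulLeft_apply]
  rw [← mul_assoc, ← pow_succ', opX_apply _ _ _ _ t.2.2, opX_apply _ _ _ _ t.2.2,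
    mul_smul_comm, smul_smul, ← pow_succ']
  split_ifs
  · rw [← mul_assoc, ← pow_succ']
  · rw [mul_smul_comm, ← pow_succ']

lemma opX_pow_one (ξ : k) (j : ℕ) (hj : j < n) : (hT.opX ξ ^ j) 1 = x ^ j := by
  induction j with
  | zero => simp
  | succ j ih =>
    rw [pow_succ', Module.End.mul_apply, ih (by omega)]
    have h := hT.opX_apply ξ 0 j (by omega)
    rw [if_pos hj] at h
    simpa using h

lemma opX_x_pow (ξ : k) (j : ℕ) (hj : j + 1 < n) : hT.opX ξ (x ^ j) = x ^ (j + 1) := by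
  rw [← hT.opX_pow_one ξ (j + 1) hj, pow_succ', Module.End.mul_apply, hT.opX_pow_one ξ j (by omega)]

lemma opX_x_pow_pred (ξ : k) (j : ℕ) (hj : j + 1 = n) : hT.opX ξ (x ^ j) = ξ • 1 := by
  have h := hT.opX_apply ξ 0 j (by omega)
  rw [if_neg (by omega)] at h
  simpa using h

/-- The Taft algebra is generated from `1` by left multiplication by `g` and by `opX ξ`. -/
lemma hom_ext (ξ : k) {V : Type} [AddCommGroup V] [Module k V] {f f' : T →ₗ[k] V}
    (h1 : f 1 = f' 1) (hg : ∀ t, f t = f' t → f (g * t) = f' (g * t))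
    (hx : ∀ t, f t = f' t → f (hT.opX ξ t) = f' (hT.opX ξ t)) : f = f' := by
  refine hT.basis.ext fun ⟨⟨i, hi⟩, ⟨j, hj⟩⟩ => ?_
  rw [basis_apply]
  dsimp only
  clear hi
  have hpow : ∀ j, f ((hT.opX ξ ^ j) 1) = f' ((hT.opX ξ ^ j) 1) := by
    intro j
    induction j with
    | zero => simpa using h1
    | succ j ih => simpa only [pow_succ', Module.End.mul_apply] using hx _ ih
  induction i with
  | zero => simpa [hT.opX_pow_one ξ j hj] using hpow j
  | succ i ih => simpa only [pow_succ', mul_assoc] using hg _ ih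

lemma opX_pow_g_mul (ξ : k) (j : ℕ) (t : T) :
    (hT.opX ξ ^ j) (g * t) = q⁻¹ ^ j • (g * (hT.opX ξ ^ j) t) := by
  induction j with
  | zero => simp
  | succ j ih =>
    rw [pow_succ', Module.End.mul_apply, ih, map_smul, opX_g_mul, smul_smul, ← pow_succ,
      Module.End.mul_apply]

lemma opX_pow_g_pow_mul (ξ : k) (i j : ℕ) (t : T) :
    (hT.opX ξ ^ j) (g ^ i * t) = q⁻¹ ^ (i * j) • (g ^ i * (hT.opX ξ ^ j) t) := by
  induction i with
  | zero => simp
  | succ i ih =>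
    rw [pow_succ', mul_assoc, opX_pow_g_mul, ih, mul_smul_comm, smul_smul, ← pow_add, mul_assoc]
    congr 2
    ring

lemma opX_pow_n (ξ : k) : hT.opX ξ ^ n = ξ • 1 := by
  refine hT.hom_ext ξ ?_ (fun t ht => ?_) fun t ht => ?_
  · obtain ⟨m, hm⟩ := Nat.exists_eq_succ_of_ne_zero hT.pos.ne'
    have h1 : (hT.opX ξ ^ m.succ) 1 = ξ • 1 := by
      rw [pow_succ', Module.End.mul_apply, hT.opX_pow_one ξ m (by omega),
        hT.opX_x_pow_pred ξ m hm.symm]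
    rwa [← hm] at h1
  · rw [opX_pow_g_mul, ht, inv_pow, hT.primitive.pow_eq_one]
    simp
  · rw [← Module.End.mul_apply, ← pow_succ, pow_succ', Module.End.mul_apply, ht]
    simp

/-- The multiplication of the algebra generated by `h` and `w` subject to `h ^ n = 1`,
`h * w = q • (w * h)`, `w ^ n = ξ`, transported to `T`. -/
def mulX (ξ : k) : T →ₗ[k] T →ₗ[k] T :=
  hT.basis.constr k fun t => LinearMap.mulLeft k (g ^ (t.1 : ℕ)) ∘ₗ hT.opX ξ ^ (t.2 : ℕ)

lemma mulX_basis (ξ : k) (i j : ℕ) (hj : j < n) (t : T) :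
    hT.mulX ξ (g ^ i * x ^ j) t = g ^ i * (hT.opX ξ ^ j) t := by
  rw [hT.g_pow_mul_x_pow_eq_basis i j hj, mulX, Module.Basis.constr_basis, LinearMap.comp_apply,
    LinearMap.mulLeft_apply, hT.g_pow_mod]

lemma mulX_one_left (ξ : k) (t : T) : hT.mulX ξ 1 t = t := by
  simpa using hT.mulX_basis ξ 0 0 hT.pos t

lemma mulX_g_mul (ξ : k) (s t : T) : hT.mulX ξ (g * s) t = g * hT.mulX ξ s t := by
  suffices h : (hT.mulX ξ).flip t ∘ₗ LinearMap.mulLeft k g =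
      LinearMap.mulLeft k g ∘ₗ (hT.mulX ξ).flip t from
    LinearMap.congr_fun h s
  refine hT.basis.ext fun s => ?_
  simp only [basis_apply, LinearMap.comp_apply, LinearMap.flip_apply, LinearMap.mulLeft_apply]
  rw [← mul_assoc, ← pow_succ', mulX_basis _ _ _ _ s.2.2, mulX_basis _ _ _ _ s.2.2, ← mul_assoc,
    ← pow_succ']

lemma mulX_opX (ξ : k) (s t : T) : hT.mulX ξ (hT.opX ξ s) t = hT.opX ξ (hT.mulX ξ s t) := by
  suffices h : (hT.mulX ξ).flip t ∘ₗ hT.opX ξ = hT.opX ξ ∘ₗ (hT.mulX ξ).flip t from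
    LinearMap.congr_fun h s
  refine hT.basis.ext fun s => ?_
  simp only [basis_apply, LinearMap.comp_apply, LinearMap.flip_apply]
  have h1 := hT.opX_pow_g_pow_mul ξ s.1 1 ((hT.opX ξ ^ (s.2 : ℕ)) t)
  rw [pow_one, mul_one, ← Module.End.mul_apply, ← pow_succ'] at h1
  rw [opX_apply _ _ _ _ s.2.2, mulX_basis _ _ _ _ s.2.2, h1, map_smul, LinearMap.smul_apply]
  split_ifs with h
  · rw [mulX_basis _ _ _ _ h]
  · have h2 : (s.2 : ℕ) + 1 = n := by have := s.2.2; omega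
    have h3 := hT.mulX_basis ξ s.1 0 hT.pos t
    rw [pow_zero, mul_one, pow_zero, Module.End.one_apply] at h3
    rw [h2, opX_pow_n, map_smul, LinearMap.smul_apply, h3]
    simp

lemma mulX_one_right (ξ : k) (s : T) : hT.mulX ξ s 1 = s := by
  suffices h : (hT.mulX ξ).flip 1 = LinearMap.id from LinearMap.congr_fun h s
  refine hT.hom_ext ξ (hT.mulX_one_left ξ 1) (fun t ht => ?_) fun t ht => ?_
  · simp only [LinearMap.flip_apply, LinearMap.id_apply] at ht ⊢
    rw [mulX_g_mul, ht]
  · simp only [LinearMap.flip_apply, LinearMap.id_apply] at ht ⊢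
    rw [mulX_opX, ht]

lemma mulX_assoc (ξ : k) (r s t : T) :
    hT.mulX ξ (hT.mulX ξ r s) t = hT.mulX ξ r (hT.mulX ξ s t) := by
  suffices h : (hT.mulX ξ).flip t ∘ₗ (hT.mulX ξ).flip s = (hT.mulX ξ).flip (hT.mulX ξ s t) from
    LinearMap.congr_fun h r
  refine hT.hom_ext ξ ?_ (fun u hu => ?_) fun u hu => ?_
  · simp [mulX_one_left]
  · simp only [LinearMap.comp_apply, LinearMap.flip_apply, mulX_g_mul] at hu ⊢
    rw [hu]
  · simp only [LinearMap.comp_apply, LinearMap.flip_apply, mulX_opX] at hu ⊢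
    rw [hu]

lemma mulX_zero (s t : T) : hT.mulX 0 s t = s * t := by
  suffices h : (hT.mulX 0).flip t = LinearMap.mulRight k t from LinearMap.congr_fun h s
  refine hT.hom_ext 0 ?_ (fun u hu => ?_) fun u hu => ?_
  · simp [mulX_one_left]
  · simp only [LinearMap.flip_apply, LinearMap.mulRight_apply, mulX_g_mul] at hu ⊢
    rw [hu, mul_assoc]
  · simp only [LinearMap.flip_apply, LinearMap.mulRight_apply, mulX_opX] at hu ⊢
    rw [hu, opX_zero, opX_zero, mul_assoc]

/-- The operator on `T ⊗ T` that `comul` intertwines with `opX (ξ + η)`. -/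
def opXX (ξ η : k) : T ⊗[k] T →ₗ[k] T ⊗[k] T :=
  TensorProduct.map (hT.opX ξ) LinearMap.id +
    TensorProduct.map (LinearMap.mulLeft k g) (hT.opX η)

lemma opXX_tmul (ξ η : k) (s t : T) :
    hT.opXX ξ η (s ⊗ₜ t) = hT.opX ξ s ⊗ₜ t + (g * s) ⊗ₜ hT.opX η t := rfl

lemma map_mulLeft_opX_mul_map_opX (ξ η : k) :
    TensorProduct.map (LinearMap.mulLeft k g) (hT.opX η) *
        TensorProduct.map (hT.opX ξ) LinearMap.id =
      q • (TensorProduct.map (hT.opX ξ) LinearMap.id *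
        TensorProduct.map (LinearMap.mulLeft k g) (hT.opX η)) := by
  ext s t
  simp [opX_g_mul, TensorProduct.smul_tmul', smul_smul, hT.q_ne_zero]

lemma opXX_pow_n (ξ η : k) : hT.opXX ξ η ^ n = (ξ + η) • 1 := by
  rw [opXX, add_pow_of_isPrimitiveRoot hT.pos hT.primitive (hT.map_mulLeft_opX_mul_map_opX ξ η),
    TensorProduct.map_pow, TensorProduct.map_pow, opX_pow_n, opX_pow_n, LinearMap.pow_mulLeft,
    hT.g_pow]
  ext s t
  simp [add_smul, TensorProduct.smul_tmul', TensorProduct.tmul_smul]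

lemma opXX_pow_one (ξ η : k) (j : ℕ) (hj : j < n) :
    (hT.opXX ξ η ^ j) (1 ⊗ₜ 1) = Coalgebra.comul (R := k) (x ^ j) := by
  have hc : (g ⊗ₜ[k] x) * (x ⊗ₜ[k] 1) = q • ((x ⊗ₜ[k] 1) * (g ⊗ₜ[k] x)) := by
    simp [hT.comm, TensorProduct.smul_tmul']
  rw [Bialgebra.comul_pow, hT.comul_x, add_pow_of_mul_eq_smul hc, opXX,
    add_pow_of_mul_eq_smul (hT.map_mulLeft_opX_mul_map_opX ξ η), LinearMap.sum_apply]
  refine Finset.sum_congr rfl fun s hs => ?_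
  have hs' := Finset.mem_range.mp hs
  have h1 := hT.opX_pow_g_pow_mul ξ (j - s) s 1
  rw [mul_one, hT.opX_pow_one ξ s (by omega), ← hT.x_pow_mul_g_pow] at h1
  rw [LinearMap.smul_apply, TensorProduct.map_pow, TensorProduct.map_pow, Module.End.mul_apply,
    TensorProduct.map_tmul, TensorProduct.map_tmul, hT.opX_pow_one η _ (by omega),
    LinearMap.pow_mulLeft, LinearMap.mulLeft_apply, mul_one, h1]
  simp [Algebra.TensorProduct.tmul_pow]

lemma opXX_g_mul (ξ η : k) (z : T ⊗[k] T) :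
    hT.opXX ξ η ((g ⊗ₜ g) * z) = q⁻¹ • ((g ⊗ₜ g) * hT.opXX ξ η z) := by
  induction z with
  | zero => simp
  | add a b ha hb => rw [mul_add, map_add, ha, hb, map_add, mul_add, smul_add]
  | tmul a b =>
    simp only [opXX_tmul, Algebra.TensorProduct.tmul_mul_tmul, opX_g_mul, mul_add, smul_add,
      TensorProduct.tmul_smul, TensorProduct.smul_tmul']

lemma comul_opX (ξ η : k) (t : T) :
    Coalgebra.comul (R := k) (hT.opX (ξ + η) t) = hT.opXX ξ η (Coalgebra.comul (R := k) t) := by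
  suffices h : Coalgebra.comul (R := k) ∘ₗ hT.opX (ξ + η) =
      hT.opXX ξ η ∘ₗ Coalgebra.comul (R := k) from LinearMap.congr_fun h t
  refine hT.basis.ext fun ⟨⟨i, hi⟩, ⟨j, hj⟩⟩ => ?_
  simp only [basis_apply, LinearMap.comp_apply]
  clear hi
  induction i with
  | zero =>
    rw [pow_zero, one_mul, ← hT.opXX_pow_one ξ η j hj, ← Module.End.mul_apply, ← pow_succ']
    rcases Nat.lt_or_ge (j + 1) n with h | h
    · rw [hT.opX_x_pow _ j h, hT.opXX_pow_one ξ η _ h]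
    · have hn : j + 1 = n := by omega
      rw [hT.opX_x_pow_pred _ j hn, hn, opXX_pow_n, map_smul, Bialgebra.comul_one]
      rfl
  | succ i ih =>
    rw [pow_succ', mul_assoc, opX_g_mul, map_smul, Bialgebra.comul_mul, Bialgebra.comul_mul,
      ih, hT.comul_g, opXX_g_mul]

/-- The coproduct intertwines `mulX (ξ + η)` with `mulX ξ ⊗ mulX η`. -/
lemma comul_comp_lift_mulX (ξ η : k) :
    Coalgebra.comul (R := k) ∘ₗ TensorProduct.lift (hT.mulX (ξ + η)) =
      TensorProduct.map (TensorProduct.lift (hT.mulX ξ)) (TensorProduct.lift (hT.mulX η)) ∘ₗ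
        Coalgebra.comul (R := k) (A := T ⊗[k] T) := by
  let Φ : (T ⊗[k] T) ⊗[k] (T ⊗[k] T) →ₗ[k] T ⊗[k] T :=
    TensorProduct.map (TensorProduct.lift (hT.mulX ξ)) (TensorProduct.lift (hT.mulX η)) ∘ₗ
      (TensorProduct.AlgebraTensorModule.tensorTensorTensorComm k k k k T T T T).toLinearMap
  have hΦ : ∀ a b c e, Φ ((a ⊗ₜ b) ⊗ₜ (c ⊗ₜ e)) = hT.mulX ξ a c ⊗ₜ hT.mulX η b e :=
    fun _ _ _ _ => rfl
  have hΦg : ∀ z y, Φ (((g ⊗ₜ g) * z) ⊗ₜ y) = (g ⊗ₜ g) * Φ (z ⊗ₜ y) := by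
    intro z y
    induction z with
    | zero => simp
    | add a b ha hb => rw [mul_add, TensorProduct.add_tmul, map_add, ha, hb, TensorProduct.add_tmul,
        map_add, mul_add]
    | tmul a b =>
      induction y with
      | zero => simp
      | add c e hc he => rw [TensorProduct.tmul_add, map_add, hc, he, TensorProduct.tmul_add,
          map_add, mul_add]
      | tmul c e =>
        simp only [Algebra.TensorProduct.tmul_mul_tmul, hΦ, mulX_g_mul]
  have hΦx : ∀ z y, Φ (hT.opXX ξ η z ⊗ₜ y) = hT.opXX ξ η (Φ (z ⊗ₜ y)) := by
    intro z y
    induction z with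
    | zero => simp
    | add a b ha hb => rw [map_add, TensorProduct.add_tmul, map_add, ha, hb, TensorProduct.add_tmul,
        map_add, map_add]
    | tmul a b =>
      induction y with
      | zero => simp
      | add c e hc he => rw [TensorProduct.tmul_add, map_add, hc, he, TensorProduct.tmul_add,
          map_add, map_add]
      | tmul c e =>
        simp only [opXX_tmul, TensorProduct.add_tmul, map_add, hΦ, mulX_g_mul, mulX_opX]
  have hΦ1 : ∀ y, Φ ((1 ⊗ₜ 1) ⊗ₜ y) = y := by
    intro y
    induction y with
    | zero => simp
    | add c e hc he => rw [TensorProduct.tmul_add, map_add, hc, he]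
    | tmul c e => simp only [hΦ, mulX_one_left]
  refine TensorProduct.ext' fun a b => ?_
  suffices h : Coalgebra.comul (R := k) ∘ₗ (hT.mulX (ξ + η)).flip b =
      Φ ∘ₗ (TensorProduct.mk k _ _).flip (Coalgebra.comul (R := k) b) ∘ₗ
        Coalgebra.comul (R := k) from LinearMap.congr_fun h a
  refine hT.hom_ext (ξ + η) ?_ (fun t ht => ?_) fun t ht => ?_
  · simp only [LinearMap.comp_apply, LinearMap.flip_apply, TensorProduct.mk_apply, mulX_one_left,
      Bialgebra.comul_one, Algebra.TensorProduct.one_def, hΦ1]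
  · simp only [LinearMap.comp_apply, LinearMap.flip_apply, TensorProduct.mk_apply, mulX_g_mul,
      Bialgebra.comul_mul, hT.comul_g, hΦg] at ht ⊢
    rw [ht]
  · simp only [LinearMap.comp_apply, LinearMap.flip_apply, TensorProduct.mk_apply, mulX_opX,
      comul_opX, hΦx] at ht ⊢
    rw [ht]

/-- The functional `ε(a * b)`, where `*` is the product `mulX ξ`. -/
def sigma (ξ : k) : T ⊗[k] T →ₗ[k] k :=
  Coalgebra.counit (R := k) ∘ₗ TensorProduct.lift (hT.mulX ξ)

lemma lift_mulX_zero : TensorProduct.lift (hT.mulX 0) = LinearMap.mul' k T :=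
  TensorProduct.ext' fun s t => hT.mulX_zero s t

lemma mulTwistL_sigma (ξ : k) :
    mulTwistL k T (hT.sigma ξ) = TensorProduct.lift (hT.mulX ξ) := by
  have h := hT.comul_comp_lift_mulX ξ 0
  rw [add_zero, lift_mulX_zero] at h
  have h2 : TensorProduct.map (hT.sigma ξ) (LinearMap.mul' k T) =
      (Coalgebra.counit (R := k)).rTensor T ∘ₗ
        TensorProduct.map (TensorProduct.lift (hT.mulX ξ)) (LinearMap.mul' k T) := by
    rw [LinearMap.rTensor_comp_map]
    rfl
  rw [mulTwistL, h2, LinearMap.comp_assoc, ← h, ← LinearMap.comp_assoc (f := TensorProduct.lift _),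
    Coalgebra.rTensor_counit_comp_comul]
  ext s t
  simp

lemma mulTwistR_sigma (ξ : k) :
    mulTwistR k T (hT.sigma ξ) = TensorProduct.lift (hT.mulX ξ) := by
  have h := hT.comul_comp_lift_mulX 0 ξ
  rw [zero_add, lift_mulX_zero] at h
  have h2 : TensorProduct.map (LinearMap.mul' k T) (hT.sigma ξ) =
      (Coalgebra.counit (R := k)).lTensor T ∘ₗ
        TensorProduct.map (LinearMap.mul' k T) (TensorProduct.lift (hT.mulX ξ)) := by
    rw [LinearMap.lTensor_comp_map]
    rfl
  rw [mulTwistR, h2, LinearMap.comp_assoc, ← h, ← LinearMap.comp_assoc (f := TensorProduct.lift _),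
    Coalgebra.lTensor_counit_comp_comul]
  ext s t
  simp

lemma conv_sigma (ξ η : k) : conv k (hT.sigma ξ) (hT.sigma η) = hT.sigma (ξ + η) := by
  have h2 : LinearMap.mul' k k ∘ₗ TensorProduct.map (Coalgebra.counit (R := k) (A := T))
      (Coalgebra.counit (R := k)) ∘ₗ Coalgebra.comul (R := k) = Coalgebra.counit (R := k) := by
    rw [← LinearMap.rTensor_comp_lTensor, LinearMap.comp_assoc,
      Coalgebra.lTensor_counit_comp_comul]
    ext t
    simp
  rw [conv, sigma, sigma, TensorProduct.map_comp, LinearMap.comp_assoc, ← comul_comp_lift_mulX,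
    ← LinearMap.comp_assoc (f := TensorProduct.lift _), ← LinearMap.comp_assoc, h2, sigma]

lemma sigma_zero : hT.sigma 0 = Coalgebra.counit (R := k) (A := T ⊗[k] T) := by
  rw [sigma, lift_mulX_zero]
  ext s t
  simp [mul_comm]

lemma cocycleLHS_eq (σ : T ⊗[k] T →ₗ[k] k) :
    cocycleLHS k T σ = σ ∘ₗ (mulTwistL k T σ).rTensor T := by
  refine TensorProduct.ext' fun z t => ?_
  simp only [cocycleLHS, mulTwistL, LinearMap.comp_apply, LinearMap.rTensor_tmul]
  generalize Coalgebra.comul (R := k) z = y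
  induction y with
  | zero => simp
  | add a b ha hb => simp only [TensorProduct.add_tmul, map_add, ha, hb]
  | tmul a b => simp [← TensorProduct.smul_tmul']

lemma cocycleRHS_eq (σ : T ⊗[k] T →ₗ[k] k) :
    cocycleRHS k T σ =
      σ ∘ₗ (mulTwistL k T σ).lTensor T ∘ₗ (TensorProduct.assoc k T T T).toLinearMap := by
  refine TensorProduct.ext_threefold fun r s t => ?_
  simp only [cocycleRHS, mulTwistL, LinearMap.comp_apply, LinearEquiv.coe_coe,
    TensorProduct.assoc_tmul, LinearMap.lTensor_tmul]
  generalize Coalgebra.comul (R := k) (s ⊗ₜ[k] t) = y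
  induction y with
  | zero => simp
  | add a b ha hb => simp only [TensorProduct.tmul_add, map_add, ha, hb]
  | tmul a b => simp

/-- The cocycle `sigma ξ`, with convolution inverse `sigma (-ξ)`. -/
def cocycle (ξ : k) : HopfTwoCocycle k T where
  σ := hT.sigma ξ
  σinv := hT.sigma (-ξ)
  conv_inv_left := by rw [conv_sigma, neg_add_cancel, sigma_zero]
  conv_inv_right := by rw [conv_sigma, add_neg_cancel, sigma_zero]
  cocycle := by
    rw [cocycleLHS_eq, cocycleRHS_eq, mulTwistL_sigma]
    refine TensorProduct.ext_threefold fun r s t => ?_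
    simp [sigma, mulX_assoc]
  unital_left t := by simp [sigma, mulX_one_left]
  unital_right t := by simp [sigma, mulX_one_right]

lemma coord_g_pow_mul_x_pow (t : Fin n × Fin n) (i s : ℕ) (hs : s < n) :
    hT.basis.coord t (g ^ i * x ^ s) = if i % n = t.1 ∧ s = t.2 then 1 else 0 := by
  rw [hT.g_pow_mul_x_pow_eq_basis i s hs, Module.Basis.coord_apply, Module.Basis.repr_self,
    Finsupp.single_apply]
  simp [Prod.ext_iff, Fin.ext_iff]

end IsTaft

/-- `A` is the comodule algebra generated by `h` and `w` subject to `h ^ d = 1`,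
`h * w = q ^ m • (w * h)`, `w ^ n = ξ`, with coaction `h ↦ g ^ m ⊗ h`, `w ↦ x ⊗ 1 + g ⊗ w`. -/
structure IsTaftComod {k : Type} [Field k] (n : ℕ) (q : k) {T : Type} [Ring T] [HopfAlgebra k T]
    (g x : T) (d m : ℕ) (ξ : k) {A : Type} [Ring A] [Algebra k A] (cA : ComodAlg k T A)
    (h w : A) : Prop where
  taft : IsTaft n q g x
  n_eq : n = d * m
  h_pow : h ^ d = 1
  comm : h * w = q ^ m • (w * h)
  w_pow : w ^ n = ξ • (1 : A)
  lam_h : cA.lam h = (g ^ m) ⊗ₜ[k] h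
  lam_w : cA.lam w = x ⊗ₜ[k] 1 + g ⊗ₜ[k] w
  linInd : LinearIndependent k (fun t : Fin d × Fin n => h ^ (t.1 : ℕ) * w ^ (t.2 : ℕ))
  span : Submodule.span k
    (Set.range (fun t : Fin d × Fin n => h ^ (t.1 : ℕ) * w ^ (t.2 : ℕ))) = ⊤

/-- The operator `a ↦ f(a₍₋₁₎) a₍₀₎` on `A` given by a functional `f` on `T`. -/
def ComodAlg.slice {k : Type} [Field k] {T : Type} [Ring T] [HopfAlgebra k T] {A : Type} [Ring A]
    [Algebra k A] (cA : ComodAlg k T A) (f : T →ₗ[k] k) : A →ₗ[k] A :=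
  (TensorProduct.lid k A).toLinearMap ∘ₗ f.rTensor A ∘ₗ cA.lam.toLinearMap

namespace IsTaftComod

variable {k : Type} [Field k] {n : ℕ} {q : k} {T : Type} [Ring T] [HopfAlgebra k T] {g x : T}
  {d m : ℕ} {ξ : k} {A : Type} [Ring A] [Algebra k A] {cA : ComodAlg k T A} {h w : A}
  (hA : IsTaftComod n q g x d m ξ cA h w)

/-- The basis `h ^ i * w ^ j` of `A`. -/
def basis : Module.Basis (Fin d × Fin n) k A := Module.Basis.mk hA.linInd hA.span.ge

lemma basis_apply (t : Fin d × Fin n) : hA.basis t = h ^ (t.1 : ℕ) * w ^ (t.2 : ℕ) := by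
  simp [basis]

lemma d_pos (hA : IsTaftComod n q g x d m ξ cA h w) : 0 < d := by
  have := hA.taft.pos
  rw [hA.n_eq] at this
  exact Nat.pos_of_mul_pos_right this

lemma m_pos (hA : IsTaftComod n q g x d m ξ cA h w) : 0 < m := by
  have := hA.taft.pos
  rw [hA.n_eq] at this
  exact Nat.pos_of_mul_pos_left this

lemma mul_lt (hA : IsTaftComod n q g x d m ξ cA h w) {i : ℕ} (hi : i < d) : m * i < n := by
  rw [hA.n_eq, mul_comm d]
  exact Nat.mul_lt_mul_of_pos_left hi hA.m_pos

lemma h_pow_mod (hA : IsTaftComod n q g x d m ξ cA h w) (i : ℕ) : h ^ (i % d) = h ^ i := by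
  conv_rhs => rw [← Nat.mod_add_div i d, pow_add, pow_mul, hA.h_pow, one_pow, mul_one]

lemma g_pow_mul_mod (hA : IsTaftComod n q g x d m ξ cA h w) (i : ℕ) :
    g ^ (m * (i % d)) = g ^ (m * i) := by
  conv_rhs => rw [← Nat.mod_add_div i d, mul_add, pow_add, ← mul_assoc, mul_comm m d, ← hA.n_eq,
    pow_mul g n, hA.taft.g_pow, one_pow, mul_one]

/-- The linear map `h ^ i * w ^ j ↦ g ^ (m * i) * x ^ j`. -/
def toTaft : A →ₗ[k] T :=
  hA.basis.constr k fun t => g ^ (m * (t.1 : ℕ)) * x ^ (t.2 : ℕ)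

lemma toTaft_apply (i j : ℕ) (hj : j < n) :
    hA.toTaft (h ^ i * w ^ j) = g ^ (m * i) * x ^ j := by
  have h1 : h ^ i * w ^ j = hA.basis (⟨i % d, Nat.mod_lt i hA.d_pos⟩, ⟨j, hj⟩) := by
    rw [basis_apply, hA.h_pow_mod]
  rw [h1, toTaft, Module.Basis.constr_basis, hA.g_pow_mul_mod]

lemma toTaft_one : hA.toTaft 1 = 1 := by
  simpa using hA.toTaft_apply 0 0 hA.taft.pos

lemma toTaft_h_mul (a : A) : hA.toTaft (h * a) = g ^ m * hA.toTaft a := by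
  suffices e : hA.toTaft ∘ₗ LinearMap.mulLeft k h = LinearMap.mulLeft k (g ^ m) ∘ₗ hA.toTaft from
    LinearMap.congr_fun e a
  refine hA.basis.ext fun t => ?_
  simp only [basis_apply, LinearMap.comp_apply, LinearMap.mulLeft_apply]
  rw [← mul_assoc, ← pow_succ', toTaft_apply _ _ _ t.2.2, toTaft_apply _ _ _ t.2.2, ← mul_assoc,
    ← pow_add, mul_add, mul_one, add_comm]

lemma toTaft_w_mul (a : A) : hA.toTaft (w * a) = hA.taft.opX ξ (hA.toTaft a) := by
  suffices e : hA.toTaft ∘ₗ LinearMap.mulLeft k w = hA.taft.opX ξ ∘ₗ hA.toTaft from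
    LinearMap.congr_fun e a
  refine hA.basis.ext fun t => ?_
  simp only [basis_apply, LinearMap.comp_apply, LinearMap.mulLeft_apply]
  have h1 : w * h ^ (t.1 : ℕ) = q⁻¹ ^ (m * (t.1 : ℕ)) • (h ^ (t.1 : ℕ) * w) := by
    have h2 := pow_mul_pow_of_mul_eq_smul hA.comm t.1 1
    rw [pow_one, mul_one, ← pow_mul] at h2
    rw [h2, smul_smul, ← mul_pow, inv_mul_cancel₀ hA.taft.q_ne_zero, one_pow, one_smul]
  rw [← mul_assoc, h1, smul_mul_assoc, mul_assoc, ← pow_succ', map_smul,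
    toTaft_apply _ _ _ t.2.2, hA.taft.opX_apply _ _ _ t.2.2]
  split_ifs with hj
  · rw [toTaft_apply _ _ _ hj]
  · have h2 : (t.2 : ℕ) + 1 = n := by have := t.2.2; omega
    have h3 := hA.toTaft_apply t.1 0 hA.taft.pos
    rw [pow_zero, mul_one, pow_zero, mul_one] at h3
    rw [h2, hA.w_pow, mul_smul_comm, mul_one, map_smul, h3]

lemma toTaft_injective : Function.Injective hA.toTaft := by
  have hinj : Function.Injective fun t : Fin d × Fin n =>
      ((⟨m * (t.1 : ℕ), hA.mul_lt t.1.2⟩, t.2) : Fin n × Fin n) := by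
    intro s t hst
    simp only [Prod.mk.injEq, Fin.mk.injEq] at hst
    exact Prod.ext (Fin.ext (Nat.eq_of_mul_eq_mul_left hA.m_pos hst.1)) hst.2
  have hli := hA.taft.linInd.comp _ hinj
  exact hA.basis.injective_constr_of_linearIndependent (R₂ := k) hli

lemma hom_ext (hA : IsTaftComod n q g x d m ξ cA h w) {V : Type} [AddCommGroup V]
    [Module k V] {f f' : A →ₗ[k] V}
    (h1 : f 1 = f' 1) (hh : ∀ a, f a = f' a → f (h * a) = f' (h * a))
    (hw : ∀ a, f a = f' a → f (w * a) = f' (w * a)) : f = f' := by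
  refine hA.basis.ext fun ⟨⟨i, hi⟩, ⟨j, hj⟩⟩ => ?_
  rw [basis_apply]
  dsimp only
  clear hi hj
  induction i with
  | zero =>
    rw [pow_zero, one_mul]
    induction j with
    | zero => simpa using h1
    | succ j ih => simpa only [pow_succ'] using hw _ ih
  | succ i ih => simpa only [pow_succ', mul_assoc] using hh _ ih

lemma toTaft_mul (a b : A) :
    hA.toTaft (a * b) = hA.taft.mulX ξ (hA.toTaft a) (hA.toTaft b) := by
  suffices e : hA.toTaft ∘ₗ LinearMap.mulRight k b =
      (hA.taft.mulX ξ).flip (hA.toTaft b) ∘ₗ hA.toTaft from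
    LinearMap.congr_fun e a
  have hg : ∀ (i : ℕ) (s t : T), hA.taft.mulX ξ (g ^ i * s) t = g ^ i * hA.taft.mulX ξ s t := by
    intro i s t
    induction i with
    | zero => simp
    | succ i ih => rw [pow_succ', mul_assoc, IsTaft.mulX_g_mul, ih, mul_assoc]
  refine hA.hom_ext ?_ (fun c hc => ?_) fun c hc => ?_
  · simp [toTaft_one, IsTaft.mulX_one_left]
  · simp only [LinearMap.comp_apply, LinearMap.mulRight_apply, LinearMap.flip_apply] at hc ⊢
    rw [mul_assoc, toTaft_h_mul, hc, toTaft_h_mul, hg]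
  · simp only [LinearMap.comp_apply, LinearMap.mulRight_apply, LinearMap.flip_apply] at hc ⊢
    rw [mul_assoc, toTaft_w_mul, hc, toTaft_w_mul, IsTaft.mulX_opX]

lemma lTensor_toTaft_lam (a : A) :
    hA.toTaft.lTensor T (cA.lam a) = Coalgebra.comul (R := k) (hA.toTaft a) := by
  suffices e : hA.toTaft.lTensor T ∘ₗ cA.lam.toLinearMap =
      Coalgebra.comul (R := k) ∘ₗ hA.toTaft from
    LinearMap.congr_fun e a
  have hh : ∀ z, hA.toTaft.lTensor T (((g ^ m) ⊗ₜ h) * z) =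
      ((g ^ m) ⊗ₜ (g ^ m)) * hA.toTaft.lTensor T z := by
    intro z
    induction z with
    | zero => simp
    | add a b ha hb => rw [mul_add, map_add, ha, hb, map_add, mul_add]
    | tmul a b => simp [toTaft_h_mul]
  have hw : ∀ z, hA.toTaft.lTensor T ((x ⊗ₜ 1 + g ⊗ₜ w) * z) =
      hA.taft.opXX 0 ξ (hA.toTaft.lTensor T z) := by
    intro z
    induction z with
    | zero => simp
    | add a b ha hb => rw [mul_add, map_add, ha, hb, map_add, map_add]
    | tmul a b => simp [add_mul, toTaft_w_mul, IsTaft.opXX_tmul, IsTaft.opX_zero]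
  refine hA.hom_ext ?_ (fun c hc => ?_) fun c hc => ?_
  · simp [toTaft_one, Algebra.TensorProduct.one_def]
  · simp only [LinearMap.comp_apply, AlgHom.toLinearMap_apply] at hc ⊢
    rw [map_mul, hA.lam_h, hh, hc, toTaft_h_mul, Bialgebra.comul_mul, Bialgebra.comul_pow,
      hA.taft.comul_g, Algebra.TensorProduct.tmul_pow]
  · simp only [LinearMap.comp_apply, AlgHom.toLinearMap_apply] at hc ⊢
    have := hA.taft.comul_opX 0 ξ (hA.toTaft c)
    rw [zero_add] at this
    rw [map_mul, hA.lam_w, hw, hc, toTaft_w_mul, this]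

lemma range_toTaft :
    LinearMap.range hA.toTaft = Subalgebra.toSubmodule (Algebra.adjoin k {g ^ m, x}) := by
  apply le_antisymm
  · rw [LinearMap.range_eq_map, ← hA.basis.span_eq, Submodule.map_span_le]
    rintro _ ⟨t, rfl⟩
    rw [basis_apply, toTaft_apply _ _ _ t.2.2, pow_mul]
    exact (Algebra.adjoin k {g ^ m, x}).mul_mem (pow_mem (Algebra.subset_adjoin (by simp)) _)
      (pow_mem (Algebra.subset_adjoin (by simp)) _)
  · have hx : ∀ a : A, x * hA.toTaft a ∈ LinearMap.range hA.toTaft := by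
      intro a
      suffices e : LinearMap.range hA.toTaft ≤
          (LinearMap.range hA.toTaft).comap (LinearMap.mulLeft k x) from e ⟨a, rfl⟩
      rw [LinearMap.range_eq_map, ← hA.basis.span_eq, Submodule.map_span_le]
      rintro _ ⟨t, rfl⟩
      rw [basis_apply, toTaft_apply _ _ _ t.2.2, Submodule.mem_comap, LinearMap.mulLeft_apply,
        ← IsTaft.opX_zero hA.taft, IsTaft.opX_apply _ _ _ _ t.2.2, zero_smul]
      refine Submodule.smul_mem _ _ ?_
      split_ifs with hj
      · rw [← hA.toTaft_apply _ _ hj]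
        exact Submodule.mem_map_of_mem (hA.basis.span_eq ▸ Submodule.mem_top)
      · exact zero_mem _
    intro s hs
    suffices e : ∀ t ∈ LinearMap.range hA.toTaft, s * t ∈ LinearMap.range hA.toTaft by
      simpa using e 1 ⟨1, hA.toTaft_one⟩
    rw [Subalgebra.mem_toSubmodule] at hs
    induction hs using Algebra.adjoin_induction with
    | mem s hs =>
      rintro _ ⟨a, rfl⟩
      rcases hs with rfl | rfl
      · exact ⟨h * a, hA.toTaft_h_mul a⟩
      · exact hx a
    | algebraMap r =>
      intro t ht
      rw [Algebra.algebraMap_eq_smul_one, smul_mul_assoc, one_mul]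
      exact Submodule.smul_mem _ _ ht
    | add s t _ _ hs ht =>
      intro u hu
      rw [add_mul]
      exact add_mem (hs u hu) (ht u hu)
    | mul s t _ _ hs ht =>
      intro u hu
      rw [mul_assoc]
      exact hs _ (ht u hu)

lemma lam_h_pow_mul_w_pow (hA : IsTaftComod n q g x d m ξ cA h w) (i j : ℕ) :
    cA.lam (h ^ i * w ^ j) =
    ∑ s ∈ Finset.range (j + 1), gaussBinom q j s •
      ((g ^ (m * i) * (x ^ s * g ^ (j - s))) ⊗ₜ[k] (h ^ i * w ^ (j - s))) := by
  have hc : (g ⊗ₜ[k] w) * (x ⊗ₜ[k] 1) = q • ((x ⊗ₜ[k] 1) * (g ⊗ₜ[k] w)) := by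
    simp [hA.taft.comm, TensorProduct.smul_tmul']
  rw [map_mul, map_pow, map_pow, hA.lam_h, hA.lam_w, add_pow_of_mul_eq_smul hc, Finset.mul_sum]
  refine Finset.sum_congr rfl fun s _ => ?_
  simp [Algebra.TensorProduct.tmul_pow, pow_mul]

lemma slice_coord_basis (i₀ : Fin d) (t : Fin d × Fin n) (j₀ : Fin n) (hj : t.2 ≤ j₀) :
    cA.slice (hA.taft.basis.coord (⟨m * (i₀ : ℕ), hA.mul_lt i₀.2⟩, j₀)) (hA.basis t) =
      if t = (i₀, j₀) then h ^ (i₀ : ℕ) else 0 := by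
  have hj' : (t.2 : ℕ) ≤ j₀ := hj
  have hcoord : ∀ s ∈ Finset.range ((t.2 : ℕ) + 1),
      hA.taft.basis.coord (⟨m * (i₀ : ℕ), hA.mul_lt i₀.2⟩, j₀)
        (g ^ (m * (t.1 : ℕ)) * (x ^ s * g ^ ((t.2 : ℕ) - s))) =
        if t = (i₀, j₀) ∧ s = t.2 then 1 else 0 := by
    intro s hs
    have hs' := Finset.mem_range.mp hs
    rw [hA.taft.x_pow_mul_g_pow, mul_smul_comm, map_smul, ← mul_assoc, ← pow_add,
      hA.taft.coord_g_pow_mul_x_pow _ _ _ (by have := t.2.2; omega)]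
    by_cases hsj : s = j₀
    · have hst : s = t.2 := by omega
      have htj : t.2 = j₀ := Fin.ext (by omega)
      simp only [hst, Nat.sub_self, add_zero, zero_mul, pow_zero, one_smul,
        Nat.mod_eq_of_lt (hA.mul_lt t.1.2), and_true, Prod.ext_iff, htj, Fin.ext_iff]
      simp [hA.m_pos.ne']
    · have : ¬ (t = (i₀, j₀) ∧ s = t.2) := by
        rintro ⟨rfl, hst⟩
        exact hsj hst
      rw [if_neg this, if_neg (fun e => hsj e.2), smul_zero]
  rw [ComodAlg.slice, LinearMap.comp_apply, LinearMap.comp_apply, AlgHom.toLinearMap_apply,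
    basis_apply, hA.lam_h_pow_mul_w_pow, map_sum, map_sum]
  have hterm : ∀ s ∈ Finset.range ((t.2 : ℕ) + 1),
      (TensorProduct.lid k A).toLinearMap
        ((hA.taft.basis.coord (⟨m * (i₀ : ℕ), hA.mul_lt i₀.2⟩, j₀)).rTensor A
        (gaussBinom q t.2 s • ((g ^ (m * (t.1 : ℕ)) * (x ^ s * g ^ ((t.2 : ℕ) - s))) ⊗ₜ[k]
          (h ^ (t.1 : ℕ) * w ^ ((t.2 : ℕ) - s))))) =
      if s = t.2 then (if t = (i₀, j₀) then h ^ (i₀ : ℕ) else 0) else 0 := by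
    intro s hs
    rw [map_smul, map_smul, LinearMap.rTensor_tmul, hcoord s hs]
    by_cases hst : s = t.2
    · by_cases ht : t = (i₀, j₀)
      · subst ht
        simp [hst, gaussBinom_self]
      · simp [ht]
    · simp [hst]
  rw [Finset.sum_congr rfl hterm, Finset.sum_ite_eq' (Finset.range _) (t.2 : ℕ)]
  simp

/-- Slicing a nonzero element along a top coordinate gives a multiple of a power of `h`. -/
lemma exists_slice_eq (hA : IsTaftComod n q g x d m ξ cA h w) (a : A) (ha : a ≠ 0) :
    ∃ (f : T →ₗ[k] k) (i : ℕ) (c : k), i < d ∧ c ≠ 0 ∧ cA.slice f a = c • h ^ i ∧ (f 1 ≠ 0 → i = 0) := by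
  have hsupp : (hA.basis.repr a).support.Nonempty := by
    rw [Finsupp.support_nonempty_iff]
    simpa using ha
  obtain ⟨⟨i₀, j₀⟩, ht₀, hmax⟩ := Finset.exists_max_image _ (fun t => t.2) hsupp
  refine ⟨hA.taft.basis.coord (⟨m * (i₀ : ℕ), hA.mul_lt i₀.2⟩, j₀), i₀,
    hA.basis.repr a (i₀, j₀), i₀.2, Finsupp.mem_support_iff.mp ht₀, ?_, fun hf => ?_⟩
  · conv_lhs => rw [← hA.basis.linearCombination_repr a, Finsupp.linearCombination_apply,
      Finsupp.sum, map_sum]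
    rw [Finset.sum_eq_single (i₀, j₀)]
    · rw [map_smul, hA.slice_coord_basis i₀ _ j₀ le_rfl, if_pos rfl]
    · intro t ht hne
      rw [map_smul, hA.slice_coord_basis i₀ t j₀ (hmax t ht), if_neg hne, smul_zero]
    · exact fun hne => absurd ht₀ hne
  · have h1 := hA.taft.coord_g_pow_mul_x_pow (⟨m * (i₀ : ℕ), hA.mul_lt i₀.2⟩, j₀) 0 0 hA.taft.pos
    rw [pow_zero, pow_zero, one_mul] at h1
    rw [h1] at hf
    by_contra hi
    refine hf (if_neg fun e => ?_)
    have := e.1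
    simp [hA.m_pos.ne'] at this
    omega

lemma rightSimple (hA : IsTaftComod n q g x d m ξ cA h w) : cA.RightSimple := by
  intro J hJ
  by_contra! hcon
  obtain ⟨a, haJ, ha⟩ := J.ne_bot_iff.mp hcon.1
  obtain ⟨f, i, c, hi, hc, hsl, -⟩ := hA.exists_slice_eq a ha
  have hmem : cA.slice f a ∈ J := by
    obtain ⟨z, hz⟩ := hJ.2 (Submodule.mem_map_of_mem haJ)
    rw [ComodAlg.slice, LinearMap.comp_apply, LinearMap.comp_apply, ← hz]
    clear hz
    induction z with
    | zero => simp
    | add y z hy hz =>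
      rw [map_add, map_add, map_add]
      exact add_mem hy hz
    | tmul s y =>
      simpa [TensorProduct.mapIncl] using J.smul_mem _ y.2
  rw [hsl, J.smul_mem_iff hc] at hmem
  have h1 := hJ.1 _ hmem (h ^ (d - i))
  rw [← pow_add, Nat.add_sub_cancel' hi.le, hA.h_pow] at h1
  exact hcon.2 (J.eq_top_iff'.mpr fun b => by simpa using hJ.1 _ h1 b)

lemma trivialCoinv (hA : IsTaftComod n q g x d m ξ cA h w) : cA.TrivialCoinv := by
  intro a
  constructor
  · intro hlam
    by_cases ha : a = 0
    · exact ⟨0, by simp [ha]⟩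
    obtain ⟨f, i, c, hi, hc, hsl, hf⟩ := hA.exists_slice_eq a ha
    have h1 : cA.slice f a = f 1 • a := by
      simp [ComodAlg.slice, hlam]
    have hunit : IsUnit h := IsUnit.of_pow_eq_one hA.h_pow hA.d_pos.ne'
    rw [h1] at hsl
    have hne : f 1 ≠ 0 := by
      intro h0
      have : Nontrivial A := ⟨a, 0, ha⟩
      rw [h0, zero_smul] at hsl
      exact (smul_ne_zero hc (hunit.pow i).ne_zero) hsl.symm
    rw [hf hne, pow_zero] at hsl
    exact ⟨(f 1)⁻¹ * c, by rw [mul_smul, ← hsl, smul_smul, inv_mul_cancel₀ hne, one_smul]⟩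
  · rintro ⟨t, rfl⟩
    rw [map_smul, map_one, Algebra.TensorProduct.one_def, TensorProduct.tmul_smul]

end IsTaftComod

/-- **Statement 12** (Lemma `tec21`).
Let `q` be a primitive `n`-th root of unity, `T_q` the Taft algebra, `d ∣ n`, `n = dm`,
and `𝒜(d,ξ)` the left `T_q`-comodule algebra `k⟨h,w | h^d = 1, hw = q^m wh, wⁿ = ξ1⟩`
with `λ(h) = g^m⊗h`, `λ(w) = x⊗1+g⊗w`.  Let `K(d)` be the left coideal subalgebra of
`T_q` generated by `g^m` and `x`.  Then for every `ξ ∈ k` there is a cocentral Hopf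
2-cocycle `σ_ξ` on `T_q` with `𝒜(d,ξ) ≅ K(d)_{σ_ξ}` as `T_q`-comodule algebras (the
twisted product on `K(d)` being `a ·σ b = σ(a₁,b₁) a₂b₂`); in particular `𝒜(d,ξ)` is a
right `T_q`-simple left `T_q`-comodule algebra with trivial coinvariants. -/
theorem stmt_12 (k : Type) [Field k] [IsAlgClosed k] [CharZero k]
    (n : ℕ) (hn : 0 < n) (q : k) (hq : IsPrimitiveRoot q n)
    -- `T = T_q`, the Taft Hopf algebra:
    (T : Type) [Ring T] [HopfAlgebra k T] (g x : T)
    (hgx : g * x = q • (x * g)) (hgn : g ^ n = 1) (hxn : x ^ n = 0)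
    (hΔg : Coalgebra.comul (R := k) g = g ⊗ₜ[k] g)
    (hΔx : Coalgebra.comul (R := k) x = x ⊗ₜ[k] 1 + g ⊗ₜ[k] x)
    (hTbasis : LinearIndependent k
        (fun t : Fin n × Fin n => g ^ (t.1 : ℕ) * x ^ (t.2 : ℕ)))
    (hTspan : Submodule.span k
        (Set.range (fun t : Fin n × Fin n => g ^ (t.1 : ℕ) * x ^ (t.2 : ℕ))) = ⊤)
    -- `A = 𝒜(d,ξ)`:
    (d m' : ℕ) (hd : n = d * m') (hd0 : 0 < d) (ξ : k)
    (A : Type) [Ring A] [Algebra k A] (cA : ComodAlg k T A) (h w : A)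
    (hhd : h ^ d = 1) (hhw : h * w = (q ^ m') • (w * h)) (hwn : w ^ n = ξ • (1 : A))
    (hlamh : cA.lam h = (g ^ m') ⊗ₜ[k] h)
    (hlamw : cA.lam w = x ⊗ₜ[k] 1 + g ⊗ₜ[k] w)
    (hAbasis : LinearIndependent k
        (fun t : Fin d × Fin n => h ^ (t.1 : ℕ) * w ^ (t.2 : ℕ)))
    (hAspan : Submodule.span k
        (Set.range (fun t : Fin d × Fin n => h ^ (t.1 : ℕ) * w ^ (t.2 : ℕ))) = ⊤)
    -- `K(d)`: the left coideal subalgebra generated by `g^m` and `x`: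
    (K : Submodule k T)
    (hK : K = Subalgebra.toSubmodule (Algebra.adjoin k {g ^ m', x})) :
    (∃ c : HopfTwoCocycle k T,
      IsCocentral k T c.σ ∧
      -- `𝒜(d,ξ) ≅ K(d)_{σ_ξ}` as `T_q`-comodule algebras:
      ∃ φ : A ≃ₗ[k] ↥K,
        ((φ 1 : T) = 1) ∧
        (∀ a b : A, (φ (a * b) : T) = mulTwistL k T c.σ ((φ a : T) ⊗ₜ[k] (φ b : T))) ∧
        (∀ a : A, TensorProduct.map (LinearMap.id (M := T)) (K.subtype ∘ₗ (φ : A →ₗ[k] ↥K))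
            (cA.lam a) = Coalgebra.comul (R := k) ((φ a : T)))) ∧
    -- in particular, `𝒜(d,ξ)` is right `T_q`-simple with trivial coinvariants:
    cA.RightSimple ∧ cA.TrivialCoinv := by
  have hT : IsTaft n q g x := ⟨hn, hq, hgx, hgn, hxn, hΔg, hΔx, hTbasis, hTspan⟩
  have hA : IsTaftComod n q g x d m' ξ cA h w :=
    ⟨hT, hd, hhd, hhw, hwn, hlamh, hlamw, hAbasis, hAspan⟩
  subst hK
  refine ⟨⟨hT.cocycle ξ, ?_, (LinearEquiv.ofInjective hA.toTaft hA.toTaft_injective).trans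
    (LinearEquiv.ofEq _ _ hA.range_toTaft), hA.toTaft_one, fun a b => ?_, fun a => ?_⟩,
    hA.rightSimple, hA.trivialCoinv⟩
  · exact (hT.mulTwistL_sigma ξ).trans (hT.mulTwistR_sigma ξ).symm
  · change hA.toTaft (a * b) = mulTwistL k T (hT.sigma ξ) (hA.toTaft a ⊗ₜ[k] hA.toTaft b)
    rw [hT.mulTwistL_sigma, hA.toTaft_mul, TensorProduct.lift.tmul]
  · exact hA.lTensor_toTaft_lam a

end HopfPaper
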